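/- arXiv:2410.08898 — 2 statements merged into one kernel-verified Lean document; each statement's English description precedes it below -/
import Mathlib

section
/- For every upper triangular matrix U ∈ ℝ^{N×N} and every x ∈ {-1,1}^N, ⟨x e_{n(x)}ᵀ, U⟩ = ∑_{1 ≤ i ≤ j ≤ N} U_{ij}·b_{ij}^{PLAA}(x). -/
open Finset Matrix

noncomputable section

def toVec {N : ℕ} (σ : Fin N → Bool) : Fin N → ℝ := fun i => if σ i then 1 else -1

def cubeLow (N N0 : ℕ) : Finset (Fin N → Bool) :=
  Finset.univ.filter (fun σ => ∀ i : Fin N, N0 ≤ (i : ℕ) → σ i = true)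

def nIdx {N : ℕ} (σ : Fin N → Bool) : ℕ :=
  Finset.univ.sup (fun i : Fin N => if σ i then 0 else (i : ℕ) + 1)

def eVec (N : ℕ) (k : ℕ) : Fin N → ℝ := fun i => if (i : ℕ) + 1 = k then 1 else 0

def outer {N : ℕ} (σ : Fin N → Bool) : Matrix (Fin N) (Fin N) ℝ :=
  Matrix.of fun i j => toVec σ i * eVec N (nIdx σ) j

def frobInner {N : ℕ} (A B : Matrix (Fin N) (Fin N) ℝ) : ℝ :=
  ∑ i, ∑ j, A i j * B i j

def maskU (N : ℕ) : Matrix (Fin N) (Fin N) ℝ :=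
  Matrix.of fun i j => if i ≤ j then 1 else 0

def bPLAA {N : ℕ} (i j : Fin N) (σ : Fin N → Bool) : ℝ :=
  (if i = j then -1 else toVec σ i) * ((1 - toVec σ j) / 2) *
    ∏ k ∈ Finset.univ.filter (fun k : Fin N => j < k), (1 + toVec σ k) / 2


theorem nIdx_eq_succ_iff {N : ℕ} (σ : Fin N → Bool) (j : Fin N) :
    (j : ℕ) + 1 = nIdx σ ↔ σ j = false ∧ ∀ k, j < k → σ k = true := by
  constructor
  · intro h
    have hle (k : Fin N) (hk : σ k = false) : (k : ℕ) ≤ j := by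
      have := Finset.le_sup (f := fun i : Fin N => if σ i then 0 else (i : ℕ) + 1)
        (Finset.mem_univ k)
      change _ ≤ nIdx σ at this
      simp only [hk, Bool.false_eq_true, if_false] at this
      omega
    refine ⟨?_, fun k hjk => ?_⟩
    · obtain ⟨m, -, hm⟩ := Finset.exists_mem_eq_sup Finset.univ ⟨j, Finset.mem_univ j⟩
        (fun i : Fin N => if σ i then 0 else (i : ℕ) + 1)
      change nIdx σ = _ at hm
      cases hσ : σ m with
      | true => simp [hσ] at hm; omega
      | false =>
        simp only [hσ, Bool.false_eq_true, if_false] at hm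
        have : m = j := Fin.ext (by omega)
        rwa [← this]
    · by_contra hk
      have := hle k (by simpa using hk)
      have : (j : ℕ) < k := hjk
      omega
  · rintro ⟨hj, hgt⟩
    apply le_antisymm
    · have := Finset.le_sup (f := fun i : Fin N => if σ i then 0 else (i : ℕ) + 1)
        (Finset.mem_univ j)
      simpa [hj, nIdx] using this
    · refine Finset.sup_le fun k _ => ?_
      cases hk : σ k with
      | true => simp
      | false =>
        have : ¬ j < k := fun h => by simp [hgt k h] at hk
        simpa using this

theorem eVec_nIdx_eq_mul_prod {N : ℕ} (σ : Fin N → Bool) (j : Fin N) :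
    eVec N (nIdx σ) j = ((1 - toVec σ j) / 2) *
      ∏ k ∈ Finset.univ.filter (fun k : Fin N => j < k), (1 + toVec σ k) / 2 := by
  have hprod : ∏ k ∈ Finset.univ.filter (fun k : Fin N => j < k), (1 + toVec σ k) / 2 =
      if ∀ k, j < k → σ k = true then 1 else 0 := by
    have hfactor (k : Fin N) : (1 + toVec σ k) / 2 = if σ k = true then (1 : ℝ) else 0 := by
      cases hk : σ k <;> norm_num [toVec, hk]
    simp [hfactor, Finset.prod_ite_zero]
  rw [hprod]
  simp only [eVec, nIdx_eq_succ_iff]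
  cases hj : σ j <;> norm_num [toVec, hj]

theorem outer_apply_eq_bPLAA {N : ℕ} (σ : Fin N → Bool) (i j : Fin N) :
    outer σ i j = bPLAA i j σ := by
  simp only [outer, Matrix.of_apply, eVec_nIdx_eq_mul_prod, bPLAA, ← mul_assoc]
  congr 1
  split_ifs with hij
  · subst hij
    cases hi : σ i <;> norm_num [toVec, hi]
  · rfl

/-- For any upper triangular `U`, `⟨x e_{n(x)}ᵀ, U⟩ = ∑_{i ≤ j} U_{ij} b_{ij}^{PLAA}(x)`. -/
theorem frobInner_upperTriangular_eq_sum_bPLAA (N : ℕ) (hN : 1 ≤ N)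
    (U : Matrix (Fin N) (Fin N) ℝ) (hU : ∀ i j : Fin N, j < i → U i j = 0)
    (σ : Fin N → Bool) :
    frobInner (outer σ) U =
      ∑ p ∈ Finset.univ.filter (fun p : Fin N × Fin N => p.1 ≤ p.2),
        U p.1 p.2 * bPLAA p.1 p.2 σ := by
  rw [frobInner, ← Fintype.sum_prod_type', Finset.sum_filter]
  refine Finset.sum_congr rfl fun p _ => ?_
  split_ifs with hp
  · rw [outer_apply_eq_bPLAA, mul_comm]
  · rw [hU _ _ (not_le.mp hp), mul_zero]

end
end

section
/- Let U_1, …, U_r be a GRPE family, b_k(x) = ⟨x e_{n(x)}ᵀ, U_k⟩, and let c ∈ ℝ^r define the concept c(x) = ∑_{k=1}^r c_k·b_k(x). Then the following are equivalent: (a) for every p' ∈ ℝ^r with ∑_{k=1}^r p'_k·b_k(x) = c(x) for all x ∈ X_{N0}, one has c_k² ≤ p'_k² for all k; (b) {k : (U_k)_{ij} = 0 for all 1 ≤ i ≤ j ≤ N0} ⊆ {k : c_k = 0}. -/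
open Finset Matrix

noncomputable section

/-- A GRPE family: upper triangular matrices of unit Frobenius norm with disjoint supports. -/
def GRPEFamily (N r : ℕ) (U : Fin r → Matrix (Fin N) (Fin N) ℝ) : Prop :=
  (∀ m : Fin r, ∀ i j : Fin N, j < i → U m i j = 0) ∧
  (∀ m : Fin r, frobInner (U m) (U m) = 1) ∧
  (∀ m m' : Fin r, m ≠ m' → ∀ i j : Fin N, U m i j * U m' i j = 0)

/-- `b_k(x) = ⟨x e_{n(x)}ᵀ, U_k⟩`. -/
def bfun {N r : ℕ} (U : Fin r → Matrix (Fin N) (Fin N) ℝ) (k : Fin r)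
    (σ : Fin N → Bool) : ℝ :=
  frobInner (outer σ) (U k)

theorem nIdx_eq_of_top {N : ℕ} {σ : Fin N → Bool} {j : Fin N} (hj : σ j = false)
    (htop : ∀ l, j < l → σ l = true) : nIdx σ = (j : ℕ) + 1 := by
  apply le_antisymm
  · refine Finset.sup_le fun l _ => ?_
    by_cases h : j < l
    · simp [htop l h]
    · have : (l : ℕ) ≤ j := not_lt.mp h
      split_ifs <;> omega
  · have := Finset.le_sup (f := fun i : Fin N => if σ i then 0 else (i : ℕ) + 1)
      (Finset.mem_univ j)
    simpa [hj, nIdx] using this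

theorem nIdx_le_of_mem_cubeLow {N N0 : ℕ} {σ : Fin N → Bool} (hσ : σ ∈ cubeLow N N0) :
    nIdx σ ≤ N0 := by
  have hσ' : ∀ i : Fin N, N0 ≤ (i : ℕ) → σ i = true := by simpa [cubeLow] using hσ
  refine Finset.sup_le fun l _ => ?_
  by_cases h : N0 ≤ (l : ℕ)
  · simp [hσ' l h]
  · split_ifs <;> omega

theorem frobInner_outer_of_top {N : ℕ} {σ : Fin N → Bool} {j : Fin N} (hj : σ j = false)
    (htop : ∀ l, j < l → σ l = true) (A : Matrix (Fin N) (Fin N) ℝ) :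
    frobInner (outer σ) A = ∑ i, toVec σ i * A i j := by
  simp [frobInner, outer, eVec, nIdx_eq_of_top hj htop, Fin.val_inj]

/-- Only the upper-left `N0 × N0` upper triangle is seen on `cubeLow N N0`. -/
theorem frobInner_outer_eq_zero {N N0 : ℕ} {A : Matrix (Fin N) (Fin N) ℝ}
    (hA : ∀ i j, j < i → A i j = 0)
    (hlow : ∀ i j : Fin N, i ≤ j → (j : ℕ) < N0 → A i j = 0)
    {σ : Fin N → Bool} (hσ : σ ∈ cubeLow N N0) : frobInner (outer σ) A = 0 := by
  have hn := nIdx_le_of_mem_cubeLow hσ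
  refine Finset.sum_eq_zero fun i _ => Finset.sum_eq_zero fun j _ => ?_
  by_cases hj : (j : ℕ) < N0
  · rcases lt_or_ge j i with h | h
    · simp [hA i j h]
    · simp [hlow i j h hj]
  · have : (j : ℕ) + 1 ≠ nIdx σ := by omega
    simp [outer, eVec, this]

/-- An upper triangular matrix orthogonal to all `outer σ` with `σ ∈ cubeLow N N0` vanishes on the
upper-left `N0 × N0` upper triangle. -/
theorem eq_zero_of_frobInner_outer_eq_zero {N N0 : ℕ} {A : Matrix (Fin N) (Fin N) ℝ}
    (hA : ∀ i j, j < i → A i j = 0)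
    (h : ∀ σ ∈ cubeLow N N0, frobInner (outer σ) A = 0)
    {i j : Fin N} (hij : i ≤ j) (hj : (j : ℕ) < N0) : A i j = 0 := by
  have key : ∀ σ : Fin N → Bool, σ j = false → (∀ l, j < l → σ l = true) →
      ∑ l, toVec σ l * A l j = 0 := by
    intro σ h1 h2
    rw [← frobInner_outer_of_top h1 h2]
    refine h σ ?_
    simp only [cubeLow, Finset.mem_filter, Finset.mem_univ, true_and]
    exact fun l hl => h2 l (Fin.lt_def.mpr (by omega))
  have base := key (fun l => !decide (l = j)) (by simp) (by intro l hl; simpa using hl.ne')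
  have off : ∀ m, m < j → A m j = 0 := by
    intro m hm
    have flip := key (fun l => !decide (l = j ∨ l = m)) (by simp)
      (by intro l hl; simpa using ⟨hl.ne', (hm.trans hl).ne'⟩)
    have hsub : ∑ l, (toVec (fun l => !decide (l = j)) l * A l j -
        toVec (fun l => !decide (l = j ∨ l = m)) l * A l j) = 0 := by
      rw [Finset.sum_sub_distrib, base, flip, sub_zero]
    rw [Finset.sum_eq_single m] at hsub
    · simp [toVec, hm.ne] at hsub
      linarith
    · intro l _ hl
      simp [toVec, hl]
    · simp
  rcases hij.lt_or_eq with hlt | rfl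
  · exact off i hlt
  · rw [Finset.sum_eq_single i] at base
    · simpa [toVec] using base
    · intro l _ hl
      rcases lt_or_gt_of_ne hl with h' | h'
      · simp [off l h']
      · simp [hA l i h']
    · simp

theorem sum_mul_bfun {N r : ℕ} (U : Fin r → Matrix (Fin N) (Fin N) ℝ) (d : Fin r → ℝ)
    (σ : Fin N → Bool) :
    ∑ k, d k * bfun U k σ = frobInner (outer σ) (∑ k, d k • U k) := by
  simp only [bfun, frobInner, Matrix.sum_apply, Matrix.smul_apply, smul_eq_mul, Finset.mul_sum]
  rw [Finset.sum_comm]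
  refine Finset.sum_congr rfl fun i _ => ?_
  rw [Finset.sum_comm]
  exact Finset.sum_congr rfl fun j _ => Finset.sum_congr rfl fun k _ => by ring

/-- Two interpolators of the same concept on `cubeLow N N0` agree at every coordinate whose matrix
has a nonzero entry in the upper-left `N0 × N0` upper triangle. -/
theorem coeff_eq_of_interpolates {N N0 r : ℕ} {U : Fin r → Matrix (Fin N) (Fin N) ℝ}
    (hU : GRPEFamily N r U) {p c : Fin r → ℝ}
    (h : ∀ σ ∈ cubeLow N N0, (∑ k, p k * bfun U k σ) = ∑ k, c k * bfun U k σ)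
    {k : Fin r} {i j : Fin N} (hij : i ≤ j) (hj : (j : ℕ) < N0) (hk : U k i j ≠ 0) :
    p k = c k := by
  obtain ⟨htri, -, hdisj⟩ := hU
  have hzero : (∑ m, (p m - c m) • U m) i j = 0 := by
    refine eq_zero_of_frobInner_outer_eq_zero (N0 := N0) ?_ ?_ hij hj
    · intro a b hab
      simp [Matrix.sum_apply, htri _ a b hab]
    · intro σ hσ
      rw [← sum_mul_bfun]
      simp [sub_mul, Finset.sum_sub_distrib, h σ hσ]
  rw [Matrix.sum_apply, Finset.sum_eq_single k] at hzero
  · simpa [hk, sub_eq_zero] using hzero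
  · intro m _ hm
    simp [(mul_eq_zero.mp (hdisj m k hm i j)).resolve_right hk]
  · simp

/-- The GRPE concept with coefficients `c` is coordinatewise minimal among all interpolators
on `X_{N0}` iff every `k` with `U_k` vanishing on the `[N0] × [N0]` upper triangle has
`c_k = 0`. -/
theorem grpe_min_iff (N N0 r : ℕ) (hN0 : 1 ≤ N0) (hN : N0 ≤ N)
    (U : Fin r → Matrix (Fin N) (Fin N) ℝ) (hU : GRPEFamily N r U)
    (c : Fin r → ℝ) :
    (∀ p' : Fin r → ℝ,
        (∀ σ ∈ cubeLow N N0, (∑ k, p' k * bfun U k σ) = ∑ k, c k * bfun U k σ) →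
        ∀ k : Fin r, (c k) ^ 2 ≤ (p' k) ^ 2) ↔
      (∀ k : Fin r, (∀ i j : Fin N, i ≤ j → (j : ℕ) < N0 → U k i j = 0) → c k = 0) := by
  constructor
  · intro h k hk
    have hmin := h (Function.update c k 0) ?_ k
    · simpa using le_antisymm hmin (by simpa using sq_nonneg (c k))
    · intro σ hσ
      refine Finset.sum_congr rfl fun m _ => ?_
      rcases eq_or_ne m k with rfl | hm
      · simp [bfun, frobInner_outer_eq_zero (hU.1 m) hk hσ]
      · simp [hm]
  · intro h p hp k
    by_cases hk : ∀ i j : Fin N, i ≤ j → (j : ℕ) < N0 → U k i j = 0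
    · simpa [h k hk] using sq_nonneg (p k)
    · push Not at hk
      obtain ⟨i, j, hij, hj, hne⟩ := hk
      rw [coeff_eq_of_interpolates hU hp hij hj hne]

end
end
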